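/- arXiv:2603.01354 — 2 statements merged into one kernel-verified Lean document; each statement's English description precedes it below -/
import Mathlib

section
/- (Proposition 6.1, case ν = 2: Virasoro relations for the Burgers-KdV hierarchy.) For an integer j ≥ −1 define the ℂ-linear operator V_{2,j} : R → R by V_{2,j} f = (1/4) · Σ_{a ∈ ℤ} :p_a p_{2j−a}:(f) + ((j+2)/2) · p_{2j}(f) + δ_{j,0} · (13/16) · f, where the sum over a ∈ ℤ is the finite sum (finsum) of the finitely many nonzero terms. Then for all integers j, k ≥ −1 with j + k ≥ −1 and every f ∈ R: V_{2,j}(V_{2,k} f) − V_{2,k}(V_{2,j} f) = (j − k) · V_{2,j+k} f. -/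
open MvPolynomial

/-- The operator `p_a` on `R = MvPolynomial ℕ ℂ`: for `a > 0` the partial
derivative with respect to `X_{a-1}` (i.e. the time variable `t_a`), for
`a < 0` multiplication by `(-a)·X_{-a-1}`, and `p_0 = 0`. -/
noncomputable def pOp (a : ℤ) : MvPolynomial ℕ ℂ → MvPolynomial ℕ ℂ :=
  if 0 < a then fun f => pderiv (a - 1).toNat f
  else if a < 0 then fun f => (((-a : ℤ) : ℂ)) • (X ((-a - 1).toNat) * f)
  else fun _ => 0

/-- The normal-ordered product `:p_a p_b:`. -/
noncomputable def nord (a b : ℤ) : MvPolynomial ℕ ℂ → MvPolynomial ℕ ℂ :=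
  if 0 < a ∧ b < 0 then pOp b ∘ pOp a else pOp a ∘ pOp b

/-- The Virasoro operator `V_{2,j}` of the Burgers-KdV hierarchy:
`V_{2,j} f = (1/4)·Σ_{a ∈ ℤ} :p_a p_{2j-a}:(f) + ((j+2)/2)·p_{2j}(f)
  + δ_{j,0}·(13/16)·f`. -/
noncomputable def V2 (j : ℤ) (f : MvPolynomial ℕ ℂ) : MvPolynomial ℕ ℂ :=
  (1 / 4 : ℂ) • (∑ᶠ a : ℤ, nord a (2 * j - a) f)
    + (((j : ℂ) + 2) / 2) • pOp (2 * j) f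
    + (if j = 0 then (13 / 16 : ℂ) • f else 0)

/-! ### The Heisenberg operators `p_a` -/

theorem pOp_of_pos {a : ℤ} (ha : 0 < a) (f : MvPolynomial ℕ ℂ) :
    pOp a f = pderiv (a - 1).toNat f := by
  simp [pOp, ha]

theorem pOp_of_neg {a : ℤ} (ha : a < 0) (f : MvPolynomial ℕ ℂ) :
    pOp a f = ((-a : ℤ) : ℂ) • (X ((-a - 1).toNat) * f) := by
  simp only [pOp, ha, ha.not_gt, if_true, if_false]

theorem pOp_zero_index (f : MvPolynomial ℕ ℂ) : pOp 0 f = 0 := by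
  simp [pOp]

theorem pOp_add (a : ℤ) (f g : MvPolynomial ℕ ℂ) : pOp a (f + g) = pOp a f + pOp a g := by
  rcases lt_trichotomy a 0 with ha | rfl | ha
  · simp only [pOp_of_neg ha, mul_add, smul_add]
  · simp [pOp_zero_index]
  · simp [pOp_of_pos ha]

theorem pOp_smul (a : ℤ) (c : ℂ) (f : MvPolynomial ℕ ℂ) : pOp a (c • f) = c • pOp a f := by
  rcases lt_trichotomy a 0 with ha | rfl | ha
  · rw [pOp_of_neg ha, pOp_of_neg ha, mul_smul_comm, smul_comm]
  · simp [pOp_zero_index]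
  · simp [pOp_of_pos ha]

/-- The operator `p_a` as a linear map. -/
noncomputable def pLin (a : ℤ) : MvPolynomial ℕ ℂ →ₗ[ℂ] MvPolynomial ℕ ℂ where
  toFun := pOp a
  map_add' := pOp_add a
  map_smul' := pOp_smul a

theorem pOp_zero (a : ℤ) : pOp a 0 = 0 := (pLin a).map_zero

theorem pOp_one_of_nonneg {a : ℤ} (ha : 0 ≤ a) : pOp a 1 = 0 := by
  rcases ha.eq_or_lt with rfl | ha
  · exact pOp_zero_index 1
  · rw [pOp_of_pos ha, pderiv_one]

theorem pderiv_X_mul (i k : ℕ) (f : MvPolynomial ℕ ℂ) :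
    pderiv i (X k * f) = X k * pderiv i f + (if i = k then f else 0) := by
  rw [pderiv_mul, pderiv_X]
  by_cases h : i = k
  · subst h; simp [add_comm]
  · simp [h]

theorem pderiv_pderiv_comm (i k : ℕ) (f : MvPolynomial ℕ ℂ) :
    pderiv i (pderiv k f) = pderiv k (pderiv i f) := by
  have h : ⁅pderiv (R := ℂ) i, pderiv (R := ℂ) k⁆ = 0 := by
    refine derivation_ext fun n => ?_
    rw [Derivation.commutator_apply]
    simp only [pderiv_X, Pi.single_apply, Derivation.zero_apply]
    split_ifs <;> simp
  rw [← sub_eq_zero, ← Derivation.commutator_apply, h, Derivation.zero_apply]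

theorem pOp_comm_of_pos_of_neg {a b : ℤ} (ha : 0 < a) (hb : b < 0) (f : MvPolynomial ℕ ℂ) :
    pOp a (pOp b f) = pOp b (pOp a f) + (if a + b = 0 then (a : ℂ) else 0) • f := by
  rw [pOp_of_neg hb, pOp_of_pos ha, pOp_of_neg hb, pOp_of_pos ha, Derivation.map_smul,
    pderiv_X_mul, smul_add]
  congr 1
  by_cases h : a + b = 0
  · obtain rfl : a = -b := by omega
    simp
  · have : (a - 1).toNat ≠ (-b - 1).toNat := by omega
    rw [if_neg h, if_neg this, smul_zero, zero_smul]

/-- The Heisenberg relation `[p_a, p_b] = a δ_{a+b,0}`. -/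
theorem pOp_comm (a b : ℤ) (f : MvPolynomial ℕ ℂ) :
    pOp a (pOp b f) = pOp b (pOp a f) + (if a + b = 0 then (a : ℂ) else 0) • f := by
  rcases lt_trichotomy a 0 with ha | rfl | ha
  · rcases lt_trichotomy b 0 with hb | rfl | hb
    · have : a + b ≠ 0 := by omega
      simp only [pOp_of_neg ha, pOp_of_neg hb, this, if_false, zero_smul, add_zero,
        mul_smul_comm]
      rw [smul_comm, mul_left_comm]
    · simp [pOp_zero_index, pOp_zero, ha.ne]
    · rw [pOp_comm_of_pos_of_neg hb ha, add_comm b a]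
      by_cases h : a + b = 0
      · obtain rfl : a = -b := by omega
        simp
      · simp [h]
  · simp [pOp_zero_index, pOp_zero]
  · rcases lt_trichotomy b 0 with hb | rfl | hb
    · exact pOp_comm_of_pos_of_neg ha hb f
    · simp [pOp_zero_index, pOp_zero, ha.ne']
    · have : a + b ≠ 0 := by omega
      simp only [pOp_of_pos ha, pOp_of_pos hb, this, if_false, zero_smul, add_zero]
      exact pderiv_pderiv_comm _ _ f

/-! ### Normal-ordered products -/

/-- The normal-ordered product as a linear map. -/
noncomputable def nordLin (a b : ℤ) : MvPolynomial ℕ ℂ →ₗ[ℂ] MvPolynomial ℕ ℂ :=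
  if 0 < a ∧ b < 0 then pLin b ∘ₗ pLin a else pLin a ∘ₗ pLin b

theorem nordLin_apply (a b : ℤ) (f : MvPolynomial ℕ ℂ) : nordLin a b f = nord a b f := by
  unfold nordLin nord
  split_ifs <;> rfl

theorem pOp_pOp_pOp (a b m : ℤ) (f : MvPolynomial ℕ ℂ) :
    pOp a (pOp b (pOp m f)) = pOp m (pOp a (pOp b f))
      + ((if a + m = 0 then (a : ℂ) else 0) • pOp b f
        + (if b + m = 0 then (b : ℂ) else 0) • pOp a f) := by
  rw [pOp_comm b m f, pOp_add, pOp_smul, pOp_comm a m (pOp b f), add_assoc]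

theorem nord_pOp (a b m : ℤ) (f : MvPolynomial ℕ ℂ) :
    nord a b (pOp m f) = pOp m (nord a b f)
      + ((if a + m = 0 then (a : ℂ) else 0) • pOp b f
        + (if b + m = 0 then (b : ℂ) else 0) • pOp a f) := by
  unfold nord
  by_cases h : 0 < a ∧ b < 0
  · simp only [h, and_self, if_true, Function.comp_apply]
    rw [pOp_pOp_pOp b a m, add_comm (_ • pOp a f)]
  · simp only [h, if_false, Function.comp_apply]
    exact pOp_pOp_pOp a b m f

theorem exists_pOp_eq_zero (f : MvPolynomial ℕ ℂ) :
    ∃ N : ℤ, ∀ a, N < a → pOp a f = 0 := by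
  obtain ⟨n, hn⟩ := f.vars.bddAbove
  refine ⟨n + 1, fun a ha => ?_⟩
  rw [pOp_of_pos (by omega)]
  refine pderiv_eq_zero_of_notMem_vars fun h => ?_
  have := hn h
  omega

theorem finite_support_nord (n : ℤ) (f : MvPolynomial ℕ ℂ) :
    (Function.support fun a : ℤ => nord a (n - a) f).Finite := by
  obtain ⟨N, hN⟩ := exists_pOp_eq_zero f
  refine (Set.finite_Icc (-(|n| + |N|)) (|n| + |N|)).subset fun a ha => ?_
  by_contra hmem
  refine ha ?_
  have h1 := le_abs_self n
  have h2 := neg_abs_le n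
  have h3 := le_abs_self N
  have h4 := abs_nonneg N
  have h5 := abs_nonneg n
  rw [Set.mem_Icc, not_and_or, not_le, not_le] at hmem
  rcases hmem with h | h
  · have hneg : ¬ (0 < a ∧ n - a < 0) := by omega
    simp only [nord, hneg, if_false, Function.comp_apply]
    rw [hN (n - a) (by omega), pOp_zero]
  · have hpos : 0 < a ∧ n - a < 0 := by omega
    simp only [nord, hpos, and_self, if_true, Function.comp_apply]
    rw [hN a (by omega), pOp_zero]

theorem finsum_ite_smul_pOp (n m : ℤ) (f : MvPolynomial ℕ ℂ) :
    ∑ᶠ a : ℤ, ((if a + m = 0 then (a : ℂ) else 0) • pOp (n - a) f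
        + (if n - a + m = 0 then ((n - a : ℤ) : ℂ) else 0) • pOp a f)
      = (-2 * (m : ℂ)) • pOp (n + m) f := by
  have h1 : ∀ a, a ≠ -m → (if a + m = 0 then (a : ℂ) else 0) • pOp (n - a) f = 0 := by
    intro a ha
    rw [if_neg (by omega), zero_smul]
  have h2 : ∀ a, a ≠ n + m →
      (if n - a + m = 0 then ((n - a : ℤ) : ℂ) else 0) • pOp a f = 0 := by
    intro a ha
    rw [if_neg (by omega), zero_smul]
  rw [finsum_add_distrib
      ((Set.finite_singleton (-m)).subset fun a ha => by_contra fun h => ha (h1 a h))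
      ((Set.finite_singleton (n + m)).subset fun a ha => by_contra fun h => ha (h2 a h)),
    finsum_eq_single _ _ h1, finsum_eq_single _ _ h2, if_pos (by omega), if_pos (by omega),
    sub_neg_eq_add, ← add_smul]
  congr 1
  push_cast
  ring

theorem finsum_nord_pOp (n m : ℤ) (f : MvPolynomial ℕ ℂ) :
    ∑ᶠ a : ℤ, nord a (n - a) (pOp m f)
      = pOp m (∑ᶠ a : ℤ, nord a (n - a) f) + (-2 * (m : ℂ)) • pOp (n + m) f := by
  have hfin := finite_support_nord n f
  have hcomm : ∑ᶠ a : ℤ, pOp m (nord a (n - a) f) = pOp m (∑ᶠ a : ℤ, nord a (n - a) f) :=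
    ((pLin m).toAddMonoidHom.map_finsum hfin).symm
  have hdiff : ∀ a : ℤ, nord a (n - a) (pOp m f) - pOp m (nord a (n - a) f)
      = (if a + m = 0 then (a : ℂ) else 0) • pOp (n - a) f
        + (if n - a + m = 0 then ((n - a : ℤ) : ℂ) else 0) • pOp a f := fun a => by
    rw [nord_pOp, add_sub_cancel_left]
  have hfin' : (Function.support fun a : ℤ => pOp m (nord a (n - a) f)).Finite :=
    hfin.subset fun a ha h => ha (by simp only [h, pOp_zero])
  rw [← hcomm, ← finsum_ite_smul_pOp, ← finsum_congr hdiff,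
    finsum_sub_distrib (finite_support_nord n _) hfin', add_sub_cancel]

/-! ### The Virasoro operators -/

theorem V2_add (j : ℤ) (f g : MvPolynomial ℕ ℂ) : V2 j (f + g) = V2 j f + V2 j g := by
  have h : ∑ᶠ a : ℤ, nord a (2 * j - a) (f + g)
      = ∑ᶠ a : ℤ, nord a (2 * j - a) f + ∑ᶠ a : ℤ, nord a (2 * j - a) g := by
    rw [← finsum_add_distrib (finite_support_nord _ f) (finite_support_nord _ g)]
    exact finsum_congr fun a => by simp only [← nordLin_apply, map_add]
  simp only [V2, h, pOp_add, smul_add]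
  split_ifs <;> abel

theorem V2_smul (j : ℤ) (c : ℂ) (f : MvPolynomial ℕ ℂ) : V2 j (c • f) = c • V2 j f := by
  have h : ∑ᶠ a : ℤ, nord a (2 * j - a) (c • f) = c • ∑ᶠ a : ℤ, nord a (2 * j - a) f := by
    rw [smul_finsum]
    exact finsum_congr fun a => by simp only [← nordLin_apply, map_smul]
  simp only [V2, h, pOp_smul]
  split_ifs <;> module

/-- The relation `[V_{2,j}, p_m] = -(m/2) p_{2j+m} + j (j+2) δ_{2j+m,0}`. -/
theorem V2_pOp (j m : ℤ) (f : MvPolynomial ℕ ℂ) :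
    V2 j (pOp m f) = pOp m (V2 j f) + (-(m : ℂ) / 2) • pOp (2 * j + m) f
      + (if 2 * j + m = 0 then (j : ℂ) * (j + 2) else 0) • f := by
  have hconst : pOp m (if j = 0 then (13 / 16 : ℂ) • f else 0)
      = if j = 0 then (13 / 16 : ℂ) • pOp m f else 0 := by
    split_ifs
    · exact pOp_smul _ _ _
    · exact pOp_zero _
  simp only [V2, finsum_nord_pOp, pOp_comm (2 * j) m f, pOp_add, pOp_smul, hconst]
  by_cases h : 2 * j + m = 0
  · simp only [h, if_true]
    push_cast
    module
  · simp only [h, if_false]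
    module

theorem V2_one_of_nonneg {j : ℤ} (hj : 0 ≤ j) :
    V2 j 1 = (if j = 0 then (13 / 16 : ℂ) else 0) • 1 := by
  have h : ∀ a : ℤ, nord a (2 * j - a) 1 = 0 := fun a => by
    unfold nord
    split_ifs with ha
    · simp only [Function.comp_apply, pOp_one_of_nonneg ha.1.le, pOp_zero]
    · by_cases hb : 0 ≤ 2 * j - a
      · simp only [Function.comp_apply, pOp_one_of_nonneg hb, pOp_zero]
      · omega
  simp only [V2, h, finsum_zero, pOp_one_of_nonneg (show 0 ≤ 2 * j by omega)]
  split_ifs <;> simp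

theorem V2_neg_one_one :
    V2 (-1) 1 = (1 / 4 : ℂ) • pOp (-1) (pOp (-1) 1) + (1 / 2 : ℂ) • pOp (-2) 1 := by
  have h : ∀ a : ℤ, a ≠ -1 → nord a (2 * (-1) - a) 1 = 0 := fun a hne => by
    unfold nord
    split_ifs with ha
    · simp only [Function.comp_apply, pOp_one_of_nonneg ha.1.le, pOp_zero]
    · by_cases hb : 0 ≤ 2 * (-1) - a
      · simp only [Function.comp_apply, pOp_one_of_nonneg hb, pOp_zero]
      · obtain rfl : a = 0 := by omega
        simp only [Function.comp_apply, pOp_zero_index]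
  rw [V2, finsum_eq_single _ _ h]
  norm_num [nord]

theorem V2_comm_neg_one_one {j : ℤ} (hj : 0 ≤ j) :
    V2 j (V2 (-1) 1) - V2 (-1) (V2 j 1) = ((j + 1 : ℤ) : ℂ) • V2 (j - 1) 1 := by
  have hV : V2 j (V2 (-1) 1)
      = (1 / 4 : ℂ) • V2 j (pOp (-1) (pOp (-1) 1)) + (1 / 2 : ℂ) • V2 j (pOp (-2) 1) := by
    rw [V2_neg_one_one, V2_add, V2_smul, V2_smul]
  rw [hV]
  simp only [V2_pOp, pOp_add, pOp_smul, V2_one_of_nonneg hj, V2_smul]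
  obtain rfl | rfl | h : j = 0 ∨ j = 1 ∨ 2 ≤ j := by omega
  · norm_num [V2_neg_one_one]
    module
  · have h1 := pOp_comm 1 (-1) 1
    norm_num [pOp_one_of_nonneg, pOp_zero] at h1
    norm_num [V2_one_of_nonneg, pOp_one_of_nonneg, pOp_zero, h1]
    module
  · have h1 := pOp_comm (2 * j + -1) (-1) 1
    have e1 : 2 * j + -1 + -1 ≠ 0 := by omega
    have e2 : 2 * j + -2 ≠ 0 := by omega
    have e3 : 2 * j + -1 ≠ 0 := by omega
    have e4 : j ≠ 0 := by omega
    have e5 : j - 1 ≠ 0 := by omega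
    rw [pOp_one_of_nonneg (show 0 ≤ 2 * j + -1 by omega), pOp_zero, if_neg e1, zero_smul,
      add_zero] at h1
    rw [h1, V2_one_of_nonneg (show 0 ≤ j - 1 by omega), pOp_one_of_nonneg (show 0 ≤ 2 * j + -1 by omega),
      pOp_one_of_nonneg (show 0 ≤ 2 * j + -2 by omega)]
    simp [e2, e3, e4, e5, pOp_zero]

theorem V2_comm_one {j k : ℤ} (hj : -1 ≤ j) (hk : -1 ≤ k) (hjk : -1 ≤ j + k) :
    V2 j (V2 k 1) - V2 k (V2 j 1) = ((j - k : ℤ) : ℂ) • V2 (j + k) 1 := by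
  obtain rfl | hj := hj.eq_or_lt
  · have h := V2_comm_neg_one_one (show 0 ≤ k by omega)
    rw [← neg_sub, h, ← neg_smul, neg_add_eq_sub]
    congr 1
    push_cast
    ring
  · obtain rfl | hk := hk.eq_or_lt
    · rw [V2_comm_neg_one_one (by omega), sub_neg_eq_add, sub_eq_add_neg]
    · rw [V2_one_of_nonneg (show 0 ≤ k by omega), V2_one_of_nonneg (show 0 ≤ j by omega),
        V2_smul, V2_smul, V2_one_of_nonneg (show 0 ≤ k by omega),
        V2_one_of_nonneg (show 0 ≤ j by omega), V2_one_of_nonneg (show 0 ≤ j + k by omega),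
        smul_comm, sub_self]
      by_cases h : j + k = 0
      · obtain ⟨rfl, rfl⟩ : j = 0 ∧ k = 0 := by omega
        simp
      · simp [h]

/-- The Virasoro relation at `f` implies the relation at `p_m f`. -/
theorem V2_comm_pOp {j k : ℤ} (m : ℤ) {f : MvPolynomial ℕ ℂ}
    (hf : V2 j (V2 k f) - V2 k (V2 j f) = ((j - k : ℤ) : ℂ) • V2 (j + k) f) :
    V2 j (V2 k (pOp m f)) - V2 k (V2 j (pOp m f))
      = ((j - k : ℤ) : ℂ) • V2 (j + k) (pOp m f) := by
  have hp : pOp m (V2 j (V2 k f)) = pOp m (V2 k (V2 j f))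
      + ((j - k : ℤ) : ℂ) • pOp m (V2 (j + k) f) := by
    rw [← pOp_smul, ← pOp_add, ← hf, add_sub_cancel]
  have e1 : 2 * j + (2 * k + m) = 2 * (j + k) + m := by ring
  have e2 : 2 * k + (2 * j + m) = 2 * (j + k) + m := by ring
  simp only [V2_pOp, V2_add, V2_smul, hp, e1, e2]
  by_cases h : 2 * (j + k) + m = 0
  · obtain rfl : m = -(2 * (j + k)) := by omega
    simp only [h, if_true]
    push_cast
    module
  · simp only [h, if_false]
    push_cast
    module

theorem mul_X_eq_smul_pOp (i : ℕ) (f : MvPolynomial ℕ ℂ) :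
    f * X i = ((i : ℂ) + 1)⁻¹ • pOp (-(i + 1)) f := by
  have hne : (i : ℂ) + 1 ≠ 0 := Nat.cast_add_one_ne_zero i
  rw [pOp_of_neg (by omega), smul_smul]
  have : (-(-((i : ℤ) + 1)) - 1).toNat = i := by omega
  rw [this]
  push_cast
  rw [neg_neg, inv_mul_cancel₀ hne, one_smul, mul_comm]

/-- Proposition 6.1, case ν = 2: the operators `V_{2,j}`,
`j ≥ -1`, satisfy the Virasoro commutation relations
`[V_{2,j}, V_{2,k}] = (j - k)·V_{2,j+k}`. -/
theorem virasoro_BurgersKdV_nu_two :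
    ∀ j k : ℤ, -1 ≤ j → -1 ≤ k → -1 ≤ j + k → ∀ f : MvPolynomial ℕ ℂ,
      V2 j (V2 k f) - V2 k (V2 j f) = ((j - k : ℤ) : ℂ) • V2 (j + k) f := by
  intro j k hj hk hjk f
  have hsmul : ∀ (c : ℂ) {g : MvPolynomial ℕ ℂ},
      V2 j (V2 k g) - V2 k (V2 j g) = ((j - k : ℤ) : ℂ) • V2 (j + k) g →
      V2 j (V2 k (c • g)) - V2 k (V2 j (c • g)) = ((j - k : ℤ) : ℂ) • V2 (j + k) (c • g) := by
    intro c g hg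
    simp only [V2_smul]
    rw [← smul_sub, hg, smul_comm]
  induction f using MvPolynomial.induction_on with
  | C c =>
    rw [C_eq_smul_one]
    exact hsmul c (V2_comm_one hj hk hjk)
  | add f g hf hg =>
    simp only [V2_add, smul_add]
    rw [add_sub_add_comm, hf, hg]
  | mul_X f i hf =>
    rw [mul_X_eq_smul_pOp]
    exact hsmul _ (V2_comm_pOp _ hf)
end

section
/- (Theorem 7.2(i), case ν = 1: Virasoro relations for the extended r-reduced KP hierarchy.) Let r ≥ 3 be an integer. For an integer j ≥ −1 define the ℂ-linear operator V_{1,j} : R → R by V_{1,j} f = (1/(2r)) · Σ_{a ∈ ℤ, r ∤ a} :p_a p_{rj−a}:(f) + δ_{j,0} · ((r² − 1)/(24r)) · f, where the sum over a ∈ ℤ not divisible by r is the finite sum (finsum) of the finitely many nonzero terms. Then for all integers j, k ≥ −1 with j + k ≥ −1 and every f ∈ R: V_{1,j}(V_{1,k} f) − V_{1,k}(V_{1,j} f) = (j − k) · V_{1,j+k} f. -/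
open MvPolynomial

/-- The Virasoro operator `V_{1,j}` of the extended `r`-reduced KP hierarchy:
`V_{1,j} f = (1/(2r))·Σ_{a ∈ ℤ, r ∤ a} :p_a p_{rj-a}:(f)
  + δ_{j,0}·((r²-1)/(24r))·f`. -/
noncomputable def V1r (r : ℤ) (j : ℤ) (f : MvPolynomial ℕ ℂ) : MvPolynomial ℕ ℂ :=
  (1 / (2 * (r : ℂ))) • (∑ᶠ a ∈ {a : ℤ | ¬ r ∣ a}, nord a (r * j - a) f)
    + (if j = 0 then (((r : ℂ) ^ 2 - 1) / (24 * (r : ℂ))) • f else 0)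

/-- The operator `p_a` as a linear endomorphism. -/
noncomputable def pEnd (a : ℤ) : Module.End ℂ (MvPolynomial ℕ ℂ) where
  toFun := pOp a
  map_add' f g := by
    unfold pOp
    split_ifs <;> simp [mul_add]
  map_smul' c f := by
    unfold pOp
    split_ifs <;> simp [smul_comm c]

/-- The normal-ordered product `:p_a p_b:` as a linear endomorphism. -/
noncomputable def nordEnd (a b : ℤ) : Module.End ℂ (MvPolynomial ℕ ℂ) :=
  if 0 < a ∧ b < 0 then pEnd b * pEnd a else pEnd a * pEnd b

lemma nordEnd_apply (a b : ℤ) (f : MvPolynomial ℕ ℂ) : nordEnd a b f = nord a b f := by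
  unfold nordEnd nord
  split_ifs <;> rfl

lemma pEnd_of_pos {a : ℤ} (ha : 0 < a) (f : MvPolynomial ℕ ℂ) :
    pEnd a f = pderiv (a - 1).toNat f := by
  simp [pEnd, pOp, ha]

lemma pEnd_of_neg {a : ℤ} (ha : a < 0) (f : MvPolynomial ℕ ℂ) :
    pEnd a f = ((-a : ℤ) : ℂ) • (X (-a - 1).toNat * f) := by
  simp [pEnd, pOp, ha, ha.le.not_gt]

lemma pEnd_zero : pEnd 0 = 0 := by
  refine LinearMap.ext fun f => ?_
  simp [pEnd, pOp]

lemma pEnd_one_of_nonneg {a : ℤ} (ha : 0 ≤ a) : pEnd a 1 = 0 := by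
  rcases ha.eq_or_lt with rfl | ha
  · simp [pEnd_zero]
  · simp [pEnd_of_pos ha]

lemma pderiv_comm (m n : ℕ) (f : MvPolynomial ℕ ℂ) :
    pderiv m (pderiv n f) = pderiv n (pderiv m f) := by
  have h : ⁅pderiv (R := ℂ) m, pderiv (R := ℂ) n⁆ = 0 := by
    refine derivation_ext fun i => ?_
    simp [Derivation.commutator_apply, pderiv_X, Pi.single_apply, apply_ite]
  simpa [Derivation.commutator_apply, sub_eq_zero] using congr($h f)

/-- The Heisenberg relations `[p_a, p_b] = a δ_{a+b,0}`. -/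
lemma pEnd_mul_pEnd (a b : ℤ) :
    pEnd a * pEnd b = pEnd b * pEnd a + (if a + b = 0 then (a : ℂ) else 0) • 1 := by
  refine LinearMap.ext fun f => ?_
  rcases lt_trichotomy a 0 with ha | rfl | ha
  · rcases lt_trichotomy b 0 with hb | rfl | hb
    · have h : a + b ≠ 0 := by lia
      simp only [Module.End.mul_apply, pEnd_of_neg ha, pEnd_of_neg hb, h, if_false, zero_smul,
        add_zero, mul_smul_comm]
      rw [smul_comm, mul_left_comm]
    · simp [pEnd_zero, ha.ne]
    · simp only [Module.End.mul_apply, LinearMap.add_apply, pEnd_of_neg ha, pEnd_of_pos hb,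
        LinearMap.smul_apply, Module.End.one_apply, Derivation.map_smul, pderiv_mul, pderiv_X, Pi.single_apply]
      by_cases h : a + b = 0
      · obtain rfl : b = -a := by lia
        simp [smul_add, add_comm]
      · have h' : (-a - 1).toNat ≠ (b - 1).toNat := by lia
        simp only [if_neg h, if_neg h', zero_mul, zero_add, zero_smul, add_zero]
  · simp [pEnd_zero]
  · rcases lt_trichotomy b 0 with hb | rfl | hb
    · simp only [Module.End.mul_apply, LinearMap.add_apply, pEnd_of_neg hb, pEnd_of_pos ha,
        LinearMap.smul_apply, Module.End.one_apply, Derivation.map_smul, pderiv_mul, pderiv_X, Pi.single_apply]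
      by_cases h : a + b = 0
      · obtain rfl : b = -a := by lia
        simp [smul_add, add_comm]
      · have h' : (-b - 1).toNat ≠ (a - 1).toNat := by lia
        simp only [if_neg h, if_neg h', zero_mul, zero_add, zero_smul, add_zero]
    · simp [pEnd_zero, ha.ne']
    · have h : a + b ≠ 0 := by lia
      simp only [Module.End.mul_apply, pEnd_of_pos ha, pEnd_of_pos hb, h, if_false, zero_smul,
        add_zero]
      exact pderiv_comm _ _ f

lemma pEnd_mul_nordEnd (b a c : ℤ) :
    pEnd b * nordEnd a c = nordEnd a c * pEnd b
      + ((if b + a = 0 then (b : ℂ) else 0) • pEnd c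
        + (if b + c = 0 then (b : ℂ) else 0) • pEnd a) := by
  have key (x y : ℤ) : pEnd b * (pEnd x * pEnd y) = pEnd x * pEnd y * pEnd b
      + ((if b + x = 0 then (b : ℂ) else 0) • pEnd y
        + (if b + y = 0 then (b : ℂ) else 0) • pEnd x) := by
    rw [← mul_assoc, pEnd_mul_pEnd b x, add_mul, mul_assoc, pEnd_mul_pEnd b y, mul_add]
    simp only [smul_mul_assoc, mul_smul_comm, one_mul, mul_one, mul_assoc]
    abel
  unfold nordEnd
  by_cases h : 0 < a ∧ c < 0
  · rw [if_pos h, key c a, add_comm (_ • pEnd a)]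
  · rw [if_neg h, key a c]

/-- The restriction of the sum defining `V_{1,j}` to the terms with `-M ≤ a ≤ M`. -/
noncomputable def truncV (r j M : ℤ) : Module.End ℂ (MvPolynomial ℕ ℂ) :=
  (1 / (2 * (r : ℂ))) • (∑ a ∈ Finset.Icc (-M) M with ¬ r ∣ a, nordEnd a (r * j - a))
    + (if j = 0 then ((r : ℂ) ^ 2 - 1) / (24 * (r : ℂ)) else 0) • 1

lemma exists_forall_lt_pEnd_eq_zero (f : MvPolynomial ℕ ℂ) :
    ∃ N : ℤ, 0 ≤ N ∧ ∀ a, N < a → pEnd a f = 0 := by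
  refine ⟨f.vars.sup id + 1, by positivity, fun a ha => ?_⟩
  rw [pEnd_of_pos (by lia)]
  refine pderiv_eq_zero_of_notMem_vars fun h => ?_
  have : (a - 1).toNat ≤ f.vars.sup id := Finset.le_sup (f := id) h
  lia

lemma eventually_V1r_eq_truncV (r j : ℤ) (f : MvPolynomial ℕ ℂ) :
    ∀ᶠ M in Filter.atTop, V1r r j f = truncV r j M f := by
  obtain ⟨N, hN, hf⟩ := exists_forall_lt_pEnd_eq_zero f
  filter_upwards [Filter.eventually_ge_atTop (N + |r * j|)] with M hM
  have hj := abs_le.1 (le_refl |r * j|)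
  have hsum : (∑ᶠ a ∈ {a : ℤ | ¬ r ∣ a}, nord a (r * j - a) f)
      = ∑ a ∈ Finset.Icc (-M) M with ¬ r ∣ a, nordEnd a (r * j - a) f := by
    simp only [← nordEnd_apply]
    refine finsum_mem_eq_sum_of_subset _ ?_ (fun a ha => by simpa using (Finset.mem_filter.1 ha).2)
    rintro a ⟨har, ha⟩
    simp only [Finset.coe_filter, Finset.mem_Icc, Set.mem_ofPred_eq]
    refine ⟨?_, har⟩
    by_contra hcon
    refine ha ?_
    by_cases h : M < a
    · have h1 : 0 < a ∧ r * j - a < 0 := by lia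
      simp [nordEnd, h1, hf a (by lia)]
    · have h1 : ¬ (0 < a ∧ r * j - a < 0) := by lia
      simp only [nordEnd, if_neg h1, Module.End.mul_apply, hf (r * j - a) (by lia), map_zero]
  unfold V1r truncV
  rw [hsum]
  split_ifs <;> simp [LinearMap.sum_apply]

/-- The operator `V_{1,j}` as a linear endomorphism. -/
noncomputable def vEnd (r j : ℤ) : Module.End ℂ (MvPolynomial ℕ ℂ) where
  toFun := V1r r j
  map_add' f g := by
    obtain ⟨M, h₁, h₂, h₃⟩ := ((eventually_V1r_eq_truncV r j f).and
      ((eventually_V1r_eq_truncV r j g).and (eventually_V1r_eq_truncV r j (f + g)))).exists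
    rw [h₁, h₂, h₃, map_add]
  map_smul' c f := by
    obtain ⟨M, h₁, h₂⟩ := ((eventually_V1r_eq_truncV r j f).and
      (eventually_V1r_eq_truncV r j (c • f))).exists
    rw [h₁, h₂, map_smul, RingHom.id_apply]

/-- The coefficient of `p_{b+rj}` in `[p_b, V_{1,j}]`: `b / r` if `r ∤ b`, and `0` otherwise. -/
noncomputable def weight (r b : ℤ) : ℂ := if r ∣ b then 0 else b / r

lemma pEnd_mul_truncV (r j b M : ℤ) (hM : |b| + |r * j| ≤ M) :
    pEnd b * truncV r j M = truncV r j M * pEnd b + weight r b • pEnd (b + r * j) := by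
  have hj := abs_le.1 (le_refl |r * j|)
  have hb := abs_le.1 (le_refl |b|)
  simp only [truncV, mul_add, add_mul, mul_smul_comm, smul_mul_assoc, mul_one, one_mul,
    Finset.mul_sum, Finset.sum_mul, pEnd_mul_nordEnd, Finset.sum_add_distrib, smul_add]
  have h₁ : ∑ a ∈ Finset.Icc (-M) M with ¬ r ∣ a,
      (if b + a = 0 then (b : ℂ) else 0) • pEnd (r * j - a)
      = (if r ∣ b then 0 else (b : ℂ)) • pEnd (b + r * j) := by
    rw [Finset.sum_filter, Finset.sum_eq_single (-b)]
    · rw [show r * j - -b = b + r * j by ring]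
      split_ifs <;> simp_all
    · intro a _ ha
      have : b + a ≠ 0 := by lia
      simp [this]
    · intro h
      simp only [Finset.mem_Icc] at h
      lia
  have h₂ : ∑ a ∈ Finset.Icc (-M) M with ¬ r ∣ a,
      (if b + (r * j - a) = 0 then (b : ℂ) else 0) • pEnd a
      = (if r ∣ b then 0 else (b : ℂ)) • pEnd (b + r * j) := by
    rw [Finset.sum_filter, Finset.sum_eq_single (b + r * j)]
    · have : r ∣ b + r * j ↔ r ∣ b := (Int.dvd_add_left (dvd_mul_right r j))
      split_ifs <;> simp_all
    · intro a _ ha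
      have : b + (r * j - a) ≠ 0 := by lia
      simp [this]
    · intro h
      simp only [Finset.mem_Icc] at h
      lia
  have hw : weight r b = 1 / (2 * (r : ℂ)) * (if r ∣ b then 0 else (b : ℂ))
      + 1 / (2 * (r : ℂ)) * (if r ∣ b then 0 else (b : ℂ)) := by
    unfold weight
    split_ifs
    · simp
    · ring
  rw [h₁, h₂, hw, add_smul, mul_smul]
  abel

lemma pEnd_mul_vEnd (r j b : ℤ) :
    pEnd b * vEnd r j = vEnd r j * pEnd b + weight r b • pEnd (b + r * j) := by
  refine LinearMap.ext fun f => ?_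
  obtain ⟨M, hM, h₁, h₂⟩ := ((Filter.eventually_ge_atTop (|b| + |r * j|)).and
    ((eventually_V1r_eq_truncV r j f).and (eventually_V1r_eq_truncV r j (pEnd b f)))).exists
  have := congr($(pEnd_mul_truncV r j b M hM) f)
  simp only [Module.End.mul_apply, LinearMap.add_apply] at this ⊢
  change pEnd b (V1r r j f) = V1r r j (pEnd b f) + _
  rw [h₁, h₂, this]

/-- The defect `[V_{1,j}, V_{1,k}] - (j - k) V_{1,j+k}` of the Virasoro relation. -/
noncomputable def virasoroDefect (r j k : ℤ) : Module.End ℂ (MvPolynomial ℕ ℂ) :=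
  vEnd r j * vEnd r k - vEnd r k * vEnd r j - ((j - k : ℤ) : ℂ) • vEnd r (j + k)

lemma weight_mul_weight_sub {r : ℤ} (hr : r ≠ 0) (j k b : ℤ) :
    weight r b * weight r (b + r * j) - weight r b * weight r (b + r * k)
      = ((j - k : ℤ) : ℂ) * weight r b := by
  have hj : r ∣ b + r * j ↔ r ∣ b := (Int.dvd_add_left (dvd_mul_right r j))
  have hk : r ∣ b + r * k ↔ r ∣ b := (Int.dvd_add_left (dvd_mul_right r k))
  have : (r : ℂ) ≠ 0 := by exact_mod_cast hr
  unfold weight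
  simp only [hj, hk]
  split_ifs
  · simp
  · push_cast
    field_simp
    ring

lemma pEnd_mul_virasoroDefect {r : ℤ} (hr : r ≠ 0) (j k b : ℤ) :
    pEnd b * virasoroDefect r j k = virasoroDefect r j k * pEnd b := by
  have h (j k : ℤ) : pEnd b * (vEnd r j * vEnd r k) = vEnd r j * vEnd r k * pEnd b
      + weight r b • (vEnd r k * pEnd (b + r * j)) + weight r b • (vEnd r j * pEnd (b + r * k))
      + (weight r b * weight r (b + r * j)) • pEnd (b + r * (j + k)) := by
    rw [← mul_assoc, pEnd_mul_vEnd, add_mul, mul_assoc, pEnd_mul_vEnd, smul_mul_assoc,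
      pEnd_mul_vEnd, mul_add, smul_add, smul_smul, mul_smul_comm, mul_assoc,
      show b + r * j + r * k = b + r * (j + k) by ring]
    abel
  have hw := weight_mul_weight_sub hr j k b
  simp only [virasoroDefect, mul_sub, sub_mul, mul_smul_comm, smul_mul_assoc]
  rw [h, h, pEnd_mul_vEnd, smul_add, smul_smul, ← hw, sub_smul, add_comm k j]
  abel

lemma virasoroDefect_apply {r : ℤ} (hr : r ≠ 0) (j k : ℤ) (f : MvPolynomial ℕ ℂ) :
    virasoroDefect r j k f = f * virasoroDefect r j k 1 := by
  induction f using MvPolynomial.induction_on with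
  | C c => rw [C_eq_smul_one, map_smul, smul_mul_assoc, one_mul]
  | add f g hf hg => rw [map_add, hf, hg, add_mul]
  | mul_X f n hf =>
    have h := congr($(pEnd_mul_virasoroDefect hr j k (-(n + 1))) f)
    have hn : -((n : ℤ) + 1) < 0 := by lia
    have hn' : ((- -((n : ℤ) + 1) : ℤ) : ℂ) ≠ 0 := by
      rw [neg_neg]
      exact_mod_cast n.succ_ne_zero
    have hX : (- -((n : ℤ) + 1) - 1).toNat = n := by lia
    simp only [Module.End.mul_apply, pEnd_of_neg hn, map_smul, hX] at h
    rw [mul_comm f, ← smul_right_injective _ hn' h, hf, mul_assoc]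

lemma nordEnd_one_of_nonneg {a c : ℤ} (h : 0 ≤ a + c) : nordEnd a c 1 = 0 := by
  unfold nordEnd
  split_ifs with h'
  · rw [Module.End.mul_apply, pEnd_one_of_nonneg h'.1.le, map_zero]
  · rw [Module.End.mul_apply, pEnd_one_of_nonneg (by lia), map_zero]

lemma vEnd_one_of_nonneg {r j : ℤ} (hr : 0 < r) (hj : 0 ≤ j) :
    vEnd r j 1 = (if j = 0 then ((r : ℂ) ^ 2 - 1) / (24 * (r : ℂ)) else 0) • 1 := by
  obtain ⟨M, hM⟩ := (eventually_V1r_eq_truncV r j 1).exists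
  have (a : ℤ) : nordEnd a (r * j - a) 1 = 0 := nordEnd_one_of_nonneg (by
    rw [add_sub_cancel]
    positivity)
  change V1r r j 1 = _
  rw [hM]
  simp only [truncV, LinearMap.add_apply, LinearMap.smul_apply, LinearMap.sum_apply, this,
    Finset.sum_const_zero, smul_zero, zero_add, Module.End.one_apply]

lemma vEnd_neg_one_one (r : ℤ) :
    vEnd r (-1) 1
      = (1 / (2 * (r : ℂ))) • ∑ b ∈ Finset.Ioo 0 r, (pEnd (-b) * pEnd (b - r)) 1 := by
  obtain ⟨M, hM, hrM⟩ := ((eventually_V1r_eq_truncV r (-1) 1).and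
    (Filter.eventually_ge_atTop r)).exists
  change V1r r (-1) 1 = _
  rw [hM]
  simp only [truncV, LinearMap.add_apply, LinearMap.smul_apply, LinearMap.sum_apply]
  rw [if_neg (by norm_num), zero_smul, add_zero]
  congr 1
  symm
  refine Finset.sum_of_injOn (fun b => -b) (fun _ _ _ _ h => neg_injective h) ?_ ?_ ?_
  · intro b hb
    simp only [Finset.coe_Ioo, Set.mem_Ioo] at hb
    simp only [Finset.coe_filter, Finset.mem_Icc, Set.mem_ofPred_eq, dvd_neg]
    exact ⟨by lia, fun h => (Int.le_of_dvd hb.1 h).not_gt hb.2⟩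
  · intro a ha hna
    simp only [Finset.mem_filter, Finset.mem_Icc] at ha
    have ha0 : a ≠ 0 := by
      rintro rfl
      simp at ha
    have har : a ≠ -r := by
      rintro rfl
      simp at ha
    have hna' : ¬ (-r < a ∧ a < 0) := fun h => hna ⟨-a, by simp; lia, by simp⟩
    unfold nordEnd
    split_ifs with h'
    · rw [Module.End.mul_apply, pEnd_one_of_nonneg h'.1.le, map_zero]
    · rw [Module.End.mul_apply, pEnd_one_of_nonneg (by lia), map_zero]
  · intro b hb
    simp only [Finset.mem_Ioo] at hb
    have h : ¬ (0 < -b ∧ r * -1 - -b < 0) := by lia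
    rw [nordEnd, if_neg h, show r * -1 - -b = b - r by ring]

lemma sum_Ioo_mul_sub {r : ℤ} (hr : 0 < r) :
    ∑ b ∈ Finset.Ioo 0 r, (b : ℂ) * (r - b) = r * (r ^ 2 - 1) / 6 := by
  lift r to ℕ using hr.le
  have h (n : ℕ) (x : ℂ) : ∑ b ∈ Finset.range n, (b : ℂ) * (x - b)
      = x * (n * (n - 1) / 2) - n * (n - 1) * (2 * n - 1) / 6 := by
    induction n with
    | zero => simp
    | succ n ih =>
      rw [Finset.sum_range_succ, ih]
      push_cast
      ring
  have h' : ∑ b ∈ Finset.Ioo 0 (r : ℤ), (b : ℂ) * ((r : ℤ) - b)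
      = ∑ b ∈ Finset.range r, (b : ℂ) * (r - b) := by
    refine Finset.sum_of_injOn Int.toNat ?_ ?_ ?_ ?_
    · intro a ha b hb hab
      simp only [Finset.coe_Ioo, Set.mem_Ioo] at ha hb
      lia
    · intro a ha
      simp only [Finset.coe_Ioo, Set.mem_Ioo] at ha
      simp only [Finset.coe_range, Set.mem_Iio]
      lia
    · intro a ha hna
      rcases Nat.eq_zero_or_pos a with rfl | h0
      · simp
      · exact absurd ⟨(a : ℤ), by simp_all, by simp⟩ hna
    · intro b hb
      simp only [Finset.mem_Ioo] at hb
      lift b to ℕ using hb.1.le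
      simp
  rw [h', h]
  push_cast
  ring

lemma vEnd_apply_pEnd_pEnd_one (r j b : ℤ) (hb : b ∈ Finset.Ioo 0 r) :
    vEnd r j ((pEnd (-b) * pEnd (b - r)) 1)
      = (pEnd (-b) * pEnd (b - r)) (vEnd r j 1)
        + ((b : ℂ) / r) • pEnd (r * j - b) (pEnd (b - r) 1)
        + (((r : ℂ) - b) / r) • pEnd (-b) (pEnd (r * j + b - r) 1) := by
  rw [Finset.mem_Ioo] at hb
  have hd : ¬ r ∣ b := fun h => (Int.le_of_dvd hb.1 h).not_gt hb.2
  have h₁ := congr($(pEnd_mul_vEnd r j (-b)) (pEnd (b - r) 1))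
  have h₂ := congr(pEnd (-b) ($(pEnd_mul_vEnd r j (b - r)) 1))
  have hd' : ¬ r ∣ b - r := by rwa [dvd_sub_self_right]
  simp only [Module.End.mul_apply, LinearMap.add_apply, LinearMap.smul_apply, weight, dvd_neg, hd,
    hd', if_false, map_add, map_smul] at h₁ h₂ ⊢
  rw [h₁] at h₂
  rw [h₂, show -b + r * j = r * j - b by ring, show b - r + r * j = r * j + b - r by ring]
  push_cast
  module

lemma virasoroDefect_neg_one_apply_one {r j : ℤ} (hr : 0 < r) (hj : 0 ≤ j) :
    virasoroDefect r j (-1) 1 = 0 := by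
  have hr0 : (r : ℂ) ≠ 0 := by exact_mod_cast hr.ne'
  simp only [virasoroDefect, LinearMap.sub_apply, LinearMap.smul_apply, Module.End.mul_apply]
  rw [vEnd_one_of_nonneg hr hj, map_smul, vEnd_neg_one_one r, map_smul, map_sum,
    Finset.sum_congr rfl (fun b hb => vEnd_apply_pEnd_pEnd_one r j b hb)]
  simp only [vEnd_one_of_nonneg hr hj, map_smul, Finset.sum_add_distrib, ← Finset.smul_sum]
  rw [add_assoc, smul_add, smul_comm, add_sub_cancel_left, ← Finset.sum_add_distrib]
  rcases hj.eq_or_lt with rfl | hj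
  · have h : vEnd r (0 + -1) 1 = vEnd r (-1) 1 := by simp
    rw [h, vEnd_neg_one_one r, sub_eq_zero]
    simp only [zero_sub, Int.reduceNeg, neg_neg, Int.cast_one, one_smul, mul_zero, zero_add]
    congr 1
    refine Finset.sum_congr rfl fun b _ => ?_
    rw [← add_smul, ← add_div, add_sub_cancel, div_self hr0, one_smul, Module.End.mul_apply]
  · rw [vEnd_one_of_nonneg hr (by lia)]
    have hterm : ∀ b ∈ Finset.Ioo 0 r, ((b : ℂ) / r) • pEnd (r * j - b) (pEnd (b - r) 1)
        + (((r : ℂ) - b) / r) • pEnd (-b) (pEnd (r * j + b - r) 1)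
        = ((b : ℂ) * (r - b)) • (if j = 1 then (1 / r : ℂ) • 1 else 0) := by
      intro b hb
      rw [Finset.mem_Ioo] at hb
      have hrj : r ≤ r * j := le_mul_of_one_le_right hr.le (by lia)
      have hcomm := congr($(pEnd_mul_pEnd (r * j - b) (b - r)) 1)
      simp only [Module.End.mul_apply, LinearMap.add_apply, LinearMap.smul_apply,
        Module.End.one_apply, pEnd_one_of_nonneg (show 0 ≤ r * j - b by lia), map_zero,
        zero_add] at hcomm
      have hiff : r * j - b + (b - r) = 0 ↔ j = 1 := by
        constructor
        · intro h
          exact mul_left_cancel₀ hr.ne' (by linarith)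
        · rintro rfl
          ring
      rw [hcomm, pEnd_one_of_nonneg (show 0 ≤ r * j + b - r by lia), map_zero, smul_zero, add_zero]
      simp only [hiff]
      split_ifs with h
      · subst h
        rw [smul_smul, smul_smul]
        congr 1
        push_cast
        ring
      · simp
    rw [Finset.sum_congr rfl hterm, ← Finset.sum_smul, sum_Ioo_mul_sub hr]
    by_cases h : j = 1
    · subst h
      simp only [if_true, smul_smul, sub_eq_zero, add_neg_cancel]
      congr 1
      push_cast
      field_simp
      ring
    · have h' : j + -1 ≠ 0 := by lia
      simp [h, h']

lemma virasoroDefect_swap (r j k : ℤ) : virasoroDefect r k j = -virasoroDefect r j k := by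
  unfold virasoroDefect
  rw [add_comm k j, ← neg_sub j k]
  push_cast
  module

lemma virasoroDefect_apply_one {r j k : ℤ} (hr : 0 < r) (hj : -1 ≤ j) (hk : -1 ≤ k)
    (hjk : -1 ≤ j + k) : virasoroDefect r j k 1 = 0 := by
  rcases hk.eq_or_lt with rfl | hk
  · exact virasoroDefect_neg_one_apply_one hr (by lia)
  rcases hj.eq_or_lt with rfl | hj
  · rw [virasoroDefect_swap, LinearMap.neg_apply, virasoroDefect_neg_one_apply_one hr (by lia),
      neg_zero]
  have hj : 0 ≤ j := by lia
  have hk : 0 ≤ k := by lia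
  simp only [virasoroDefect, LinearMap.sub_apply, LinearMap.smul_apply, Module.End.mul_apply,
    vEnd_one_of_nonneg hr hj, vEnd_one_of_nonneg hr hk, vEnd_one_of_nonneg hr (add_nonneg hj hk),
    map_smul]
  rw [smul_comm, sub_self, zero_sub, neg_eq_zero]
  split_ifs with h
  · have : j - k = 0 := by lia
    simp [this]
  · simp

/-- Theorem 7.2(i), case ν = 1: for `r ≥ 3` the operators
`V_{1,j}`, `j ≥ -1`, satisfy the Virasoro commutation relations
`[V_{1,j}, V_{1,k}] = (j - k)·V_{1,j+k}`. -/
theorem virasoro_extended_rKP_nu_one (r : ℤ) (hr : 3 ≤ r) :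
    ∀ j k : ℤ, -1 ≤ j → -1 ≤ k → -1 ≤ j + k → ∀ f : MvPolynomial ℕ ℂ,
      V1r r j (V1r r k f) - V1r r k (V1r r j f)
        = ((j - k : ℤ) : ℂ) • V1r r (j + k) f := by
  intro j k hj hk hjk f
  have h := virasoroDefect_apply (by lia : r ≠ 0) j k f
  rw [virasoroDefect_apply_one (by lia) hj hk hjk, mul_zero] at h
  exact sub_eq_zero.1 h
end
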